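/- The space V^m(𝒲) is strictly strongly locally contractible: for every μ ∈ V^m(𝒲) and every neighborhood U of μ in V^m(𝒲), there exist a neighborhood V of μ in V^m(𝒲) with V ⊆ U and a continuous map H : [0,1] × V → V such that H(0,ν) = ν for all ν ∈ V, H(1,ν) = μ for all ν ∈ V, and H(t,μ) = μ for all t ∈ [0,1] (i.e., V strongly deformation retracts onto μ). -/

import Mathlib

open MeasureTheory Set

/-- The support of a probability measure: the set of points all of whose open
neighborhoods have positive measure. -/
def msupp {X : Type*} [TopologicalSpace X] [MeasurableSpace X]
    (μ : ProbabilityMeasure X) : Set X :=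
  {x | ∀ U : Set X, IsOpen U → x ∈ U → μ.toMeasure U ≠ 0}

/-- The Vietoris metric thickening of a cover `𝒲`. -/
def VietorisThickening {X : Type*} [TopologicalSpace X] [MeasurableSpace X]
    (𝒲 : Set (Set X)) : Set (ProbabilityMeasure X) :=
  {μ | (msupp μ).Finite ∧ ∃ W ∈ 𝒲, msupp μ ⊆ W}

open scoped ENNReal NNReal Topology
open Filter

section Support

variable {X : Type*} [TopologicalSpace X] [MeasurableSpace X]

theorem msupp_eq_support (μ : ProbabilityMeasure X) : msupp μ = (μ : Measure X).support := by
  rw [Measure.support_eq_forall_isOpen]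
  ext x
  simp only [msupp, Set.mem_ofPred_eq, pos_iff_ne_zero]
  exact ⟨fun h U hx hU => h U hU hx, fun h U hU hx => h U hx hU⟩

theorem measure_compl_msupp [HereditarilyLindelofSpace X] (μ : ProbabilityMeasure X) :
    (μ : Measure X) (msupp μ)ᶜ = 0 := by
  rw [msupp_eq_support, Measure.measure_compl_support]

theorem msupp_subset_of_isClosed {μ : ProbabilityMeasure X} {T : Set X} (hT : IsClosed T)
    (h : (μ : Measure X) Tᶜ = 0) : msupp μ ⊆ T := by
  rw [msupp_eq_support]
  exact Measure.support_subset_of_isClosed hT h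

theorem msupp_nonempty [HereditarilyLindelofSpace X] (μ : ProbabilityMeasure X) :
    (msupp μ).Nonempty := by
  rw [msupp_eq_support]
  exact Measure.nonempty_support (IsProbabilityMeasure.ne_zero _)

theorem measure_singleton_pos_of_mem_msupp [T1Space X] [HereditarilyLindelofSpace X]
    {μ : ProbabilityMeasure X} (hfin : (msupp μ).Finite) {x : X} (hx : x ∈ msupp μ) :
    0 < (μ : Measure X) {x} := by
  have h := hx (msupp μ \ {x})ᶜ (hfin.sdiff.isClosed.isOpen_compl) (by simp)
  refine pos_iff_ne_zero.2 fun h0 => h (measure_mono_null ?_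
    (measure_union_null (measure_compl_msupp μ) h0))
  intro y hy
  by_cases hyx : y = x <;> simp_all

end Support

namespace MeasureTheory.ProbabilityMeasure

section Mix

variable {X : Type*} [MeasurableSpace X]

/-- The convex combination `(1 - t) μ + t ν` of two probability measures. -/
noncomputable def mix (t : unitInterval) (μ ν : ProbabilityMeasure X) : ProbabilityMeasure X :=
  ⟨ENNReal.ofReal (1 - t) • (μ : Measure X) + ENNReal.ofReal t • (ν : Measure X), ⟨by
    simp [← ENNReal.ofReal_add (sub_nonneg.2 t.2.2) t.2.1]⟩⟩

theorem mix_apply (t : unitInterval) (μ ν : ProbabilityMeasure X) (s : Set X) :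
    (mix t μ ν : Measure X) s =
      ENNReal.ofReal (1 - t) * (μ : Measure X) s + ENNReal.ofReal t * (ν : Measure X) s := by
  simp [mix]

@[simp] theorem mix_zero (μ ν : ProbabilityMeasure X) : mix 0 μ ν = μ := by
  apply Subtype.ext; simp [mix]

@[simp] theorem mix_one (μ ν : ProbabilityMeasure X) : mix 1 μ ν = ν := by
  apply Subtype.ext; simp [mix]

@[simp] theorem mix_self (t : unitInterval) (μ : ProbabilityMeasure X) : mix t μ μ = μ := by
  apply eq_of_forall_toMeasure_apply_eq
  intro s _
  rw [mix_apply, ← add_mul, ← ENNReal.ofReal_add (sub_nonneg.2 t.2.2) t.2.1]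
  simp

theorem mix_apply_eq_zero {t : unitInterval} {μ ν : ProbabilityMeasure X} {s : Set X}
    (hμ : (μ : Measure X) s = 0) (hν : (ν : Measure X) s = 0) : (mix t μ ν : Measure X) s = 0 := by
  simp [mix_apply, hμ, hν]

theorem min_le_mix_apply (t : unitInterval) (μ ν : ProbabilityMeasure X) (s : Set X) :
    min ((μ : Measure X) s) ((ν : Measure X) s) ≤ (mix t μ ν : Measure X) s := by
  set m := min ((μ : Measure X) s) ((ν : Measure X) s)
  calc m = ENNReal.ofReal (1 - t) * m + ENNReal.ofReal t * m := by
        rw [← add_mul, ← ENNReal.ofReal_add (sub_nonneg.2 t.2.2) t.2.1]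
        simp
    _ ≤ _ := by
        rw [mix_apply]
        gcongr
        exacts [min_le_left _ _, min_le_right _ _]

theorem integral_mix (t : unitInterval) (μ ν : ProbabilityMeasure X) {f : X → ℝ}
    (hμ : Integrable f (μ : Measure X)) (hν : Integrable f (ν : Measure X)) :
    ∫ x, f x ∂(mix t μ ν : Measure X) =
      (1 - t) * ∫ x, f x ∂(μ : Measure X) + t * ∫ x, f x ∂(ν : Measure X) := by
  simp only [mix, coe_mk]
  rw [integral_add_measure (hμ.smul_measure ENNReal.ofReal_ne_top)
    (hν.smul_measure ENNReal.ofReal_ne_top), integral_smul_measure, integral_smul_measure,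
    ENNReal.toReal_ofReal (sub_nonneg.2 t.2.2), ENNReal.toReal_ofReal t.2.1]
  rfl

theorem continuous_mix [TopologicalSpace X] [OpensMeasurableSpace X] {A : Type*}
    [TopologicalSpace A] {t : A → unitInterval} {μ ν : A → ProbabilityMeasure X}
    (ht : Continuous t) (hμ : Continuous μ) (hν : Continuous ν) :
    Continuous fun a => mix (t a) (μ a) (ν a) := by
  rw [continuous_iff_forall_continuous_integral]
  intro f
  simp only [integral_mix _ _ _ (f.integrable _) (f.integrable _)]
  have h1 := (continuous_integral_boundedContinuousFunction f).comp hμ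
  have h2 := (continuous_integral_boundedContinuousFunction f).comp hν
  simp only [Function.comp_def] at h1 h2
  fun_prop

end Mix

section Reweight

theorem lintegral_continuousMap_ne_top {X : Type*} [TopologicalSpace X] [CompactSpace X]
    [MeasurableSpace X] [OpensMeasurableSpace X] (φ : C(X, ℝ≥0)) (μ : ProbabilityMeasure X) :
    ∫⁻ x, φ x ∂(μ : Measure X) ≠ ∞ :=
  ((BoundedContinuousFunction.mkOfCompact φ).lintegral_lt_top_of_nnreal (μ : Measure X)).ne

variable {X : Type*} [TopologicalSpace X] [CompactSpace X] [MeasurableSpace X] [BorelSpace X]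

/-- The probability measure with density proportional to `φ` with respect to `μ`. -/
noncomputable def reweight (φ : C(X, ℝ≥0)) (μ : ProbabilityMeasure X)
    (h : ∫⁻ x, φ x ∂(μ : Measure X) ≠ 0) : ProbabilityMeasure X :=
  ⟨(∫⁻ x, φ x ∂(μ : Measure X))⁻¹ • (μ : Measure X).withDensity fun x => φ x, ⟨by
    simp [ENNReal.inv_mul_cancel h (lintegral_continuousMap_ne_top φ μ)]⟩⟩

variable {φ : C(X, ℝ≥0)}

theorem reweight_apply_eq_zero {μ : ProbabilityMeasure X} (h : ∫⁻ x, φ x ∂(μ : Measure X) ≠ 0)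
    {s : Set X} (hs : (μ : Measure X) s = 0) : (reweight φ μ h : Measure X) s = 0 := by
  simp [reweight, withDensity_absolutelyContinuous _ _ hs]

theorem reweight_apply_setOf_eq_zero {μ : ProbabilityMeasure X}
    (h : ∫⁻ x, φ x ∂(μ : Measure X) ≠ 0) : (reweight φ μ h : Measure X) {x | φ x = 0} = 0 := by
  have hm : MeasurableSet {x | φ x = 0} := (isClosed_eq φ.continuous continuous_const).measurableSet
  have : ∫⁻ x in {x | φ x = 0}, φ x ∂(μ : Measure X) = 0 := by
    rw [setLIntegral_congr_fun (g := 0) hm]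
    · simp
    · intro x hx
      simpa using hx
  simp [reweight, withDensity_apply _ hm, this]

theorem le_reweight_apply {μ : ProbabilityMeasure X} (h : ∫⁻ x, φ x ∂(μ : Measure X) ≠ 0)
    (hφ : ∀ x, φ x ≤ 1) {s : Set X} (hm : MeasurableSet s) (hs : ∀ x ∈ s, φ x = 1) :
    (μ : Measure X) s ≤ (reweight φ μ h : Measure X) s := by
  have h1 : ∫⁻ x, φ x ∂(μ : Measure X) ≤ 1 := by
    calc ∫⁻ x, φ x ∂(μ : Measure X) ≤ ∫⁻ _, 1 ∂(μ : Measure X) :=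
          lintegral_mono fun x => ENNReal.coe_le_one_iff.2 (hφ x)
      _ = 1 := by simp
  have h2 : ∫⁻ x in s, φ x ∂(μ : Measure X) = (μ : Measure X) s := by
    rw [setLIntegral_congr_fun (g := 1) hm]
    · simp
    · intro x hx
      simp [hs x hx]
  simp only [reweight, coe_mk, Measure.smul_apply, withDensity_apply _ hm, h2, smul_eq_mul]
  exact le_mul_of_one_le_left zero_le (ENNReal.one_le_inv.2 h1)

theorem reweight_eq_self {μ : ProbabilityMeasure X} (h : ∫⁻ x, φ x ∂(μ : Measure X) ≠ 0)
    (hφ : ∀ᵐ x ∂(μ : Measure X), φ x = 1) : reweight φ μ h = μ := by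
  have hae : (fun x => (φ x : ℝ≥0∞)) =ᵐ[(μ : Measure X)] 1 := by
    filter_upwards [hφ] with x hx
    simp [hx]
  apply Subtype.ext
  simp only [reweight, lintegral_congr_ae hae, withDensity_congr_ae hae]
  simp

theorem integral_reweight {μ : ProbabilityMeasure X} (h : ∫⁻ x, φ x ∂(μ : Measure X) ≠ 0)
    (f : X → ℝ) : ∫ x, f x ∂(reweight φ μ h : Measure X) =
      (∫⁻ x, φ x ∂(μ : Measure X)).toReal⁻¹ * ∫ x, (φ x : ℝ) * f x ∂(μ : Measure X) := by
  simp only [reweight, coe_mk]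
  rw [integral_smul_measure, integral_withDensity_eq_integral_smul φ.continuous.measurable,
    ENNReal.toReal_inv]
  rfl

theorem continuous_reweight {A : Type*} [TopologicalSpace A] {μ : A → ProbabilityMeasure X}
    (hμ : Continuous μ) (h : ∀ a, ∫⁻ x, φ x ∂(μ a : Measure X) ≠ 0) :
    Continuous fun a => reweight φ (μ a) (h a) := by
  rw [continuous_iff_forall_continuous_integral]
  intro f
  simp only [integral_reweight]
  have h1 : Continuous fun a => ∫⁻ x, φ x ∂(μ a : Measure X) :=
    (continuous_lintegral_continuousMap φ).comp hμ
  have h2 : Continuous fun a => (∫⁻ x, φ x ∂(μ a : Measure X)).toReal :=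
    ENNReal.continuousOn_toReal.comp_continuous h1 fun a => lintegral_continuousMap_ne_top φ (μ a)
  let g : C(X, ℝ) := ⟨fun x => (φ x : ℝ) * f x, by fun_prop⟩
  have h3 : Continuous fun a => ∫ x, (φ x : ℝ) * f x ∂(μ a : Measure X) :=
    (continuous_integral_continuousMap g).comp hμ
  exact (h2.inv₀ fun a => ENNReal.toReal_ne_zero.2
    ⟨h a, lintegral_continuousMap_ne_top φ (μ a)⟩).mul h3

end Reweight

section MassNear

variable {X : Type*} [MetricSpace X] [MeasurableSpace X]

/-- The probability measures giving each ball of radius `ε` around a point `x` of the support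
of `μ` mass more than `μ {x} - ε`. -/
def massNear (μ : ProbabilityMeasure X) (ε : ℝ) : Set (ProbabilityMeasure X) :=
  {ν | ∀ x ∈ msupp μ, (μ : Measure X) {x} - ENNReal.ofReal ε < (ν : Measure X) (Metric.ball x ε)}

variable {μ : ProbabilityMeasure X} {ε : ℝ}

theorem mix_mem_massNear {ν₁ ν₂ : ProbabilityMeasure X} (h₁ : ν₁ ∈ massNear μ ε)
    (h₂ : ν₂ ∈ massNear μ ε) (t : unitInterval) : mix t ν₁ ν₂ ∈ massNear μ ε :=
  fun x hx => (lt_min (h₁ x hx) (h₂ x hx)).trans_le (min_le_mix_apply t ν₁ ν₂ _)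

theorem self_mem_massNear [HereditarilyLindelofSpace X] (hfin : (msupp μ).Finite) (hε : 0 < ε) :
    μ ∈ massNear μ ε := fun x hx =>
  (ENNReal.sub_lt_self (measure_ne_top _ _) (measure_singleton_pos_of_mem_msupp hfin hx).ne'
    (by simpa using hε)).trans_le (measure_mono (by simpa using hε))

theorem isOpen_massNear [OpensMeasurableSpace X] (hfin : (msupp μ).Finite) :
    IsOpen (massNear μ ε) := by
  have : massNear μ ε = ⋂ x ∈ msupp μ,
      {ν : ProbabilityMeasure X |
        (μ : Measure X) {x} - ENNReal.ofReal ε < (ν : Measure X) (Metric.ball x ε)} := by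
    ext ν
    simp [massNear]
  rw [this]
  refine hfin.isOpen_biInter fun x _ => isOpen_iff_mem_nhds.2 fun ν hν => ?_
  exact eventually_lt_of_lt_liminf
    (lt_of_lt_of_le hν (le_liminf_measure_open_of_tendsto tendsto_id Metric.isOpen_ball))

theorem tendsto_of_mem_massNear [BorelSpace X] [HereditarilyLindelofSpace X]
    (hfin : (msupp μ).Finite) {ν : ℕ → ProbabilityMeasure X} {ε : ℕ → ℝ}
    (hε : Tendsto ε atTop (𝓝 0)) (hν : ∀ n, ν n ∈ massNear μ (ε n)) :
    Tendsto ν atTop (𝓝 μ) := by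
  refine tendsto_of_forall_isOpen_le_liminf_nat' fun G hG => ?_
  have hTfin : (msupp μ ∩ G).Finite := hfin.inter_of_left G
  set T := hTfin.toFinset with hT
  have hmem : ∀ x, x ∈ T ↔ x ∈ msupp μ ∧ x ∈ G := by simp [hT]
  have hμG : (μ : Measure X) G ≤ ∑ x ∈ T, (μ : Measure X) {x} := by
    calc (μ : Measure X) G ≤ (μ : Measure X) ((msupp μ ∩ G) ∪ (msupp μ)ᶜ) := by
          apply measure_mono
          intro x hx
          by_cases h : x ∈ msupp μ <;> simp [h, hx]
      _ ≤ (μ : Measure X) (msupp μ ∩ G) + (μ : Measure X) (msupp μ)ᶜ := measure_union_le _ _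
      _ = (μ : Measure X) T := by simp [measure_compl_msupp, hT]
      _ = ∑ x ∈ T, (μ : Measure X) {x} := (sum_measure_singleton).symm
  have hsmall : ∀ᶠ n in atTop, ∀ x ∈ T, Metric.ball x (ε n) ⊆ G := by
    rw [Finset.eventually_all]
    intro x hx
    obtain ⟨δ, hδ, hδG⟩ := Metric.isOpen_iff.1 hG x ((hmem x).1 hx).2
    filter_upwards [hε.eventually_lt_const hδ] with n hn
    exact (Metric.ball_subset_ball hn.le).trans hδG
  have hdisj : ∀ᶠ n in atTop, ∀ x ∈ T, ∀ y ∈ T, x ≠ y →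
      Disjoint (Metric.ball x (ε n)) (Metric.ball y (ε n)) := by
    rw [Finset.eventually_all]
    intro x _
    rw [Finset.eventually_all]
    intro y _
    by_cases hxy : x = y
    · simp [hxy]
    filter_upwards [hε.eventually_lt_const (half_pos (dist_pos.2 hxy))] with n hn _
    exact Metric.ball_disjoint_ball (by linarith)
  have hle : ∀ᶠ n in atTop,
      ∑ x ∈ T, ((μ : Measure X) {x} - ENNReal.ofReal (ε n)) ≤ (ν n : Measure X) G := by
    filter_upwards [hsmall, hdisj] with n h1 h2
    calc ∑ x ∈ T, ((μ : Measure X) {x} - ENNReal.ofReal (ε n))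
        ≤ ∑ x ∈ T, (ν n : Measure X) (Metric.ball x (ε n)) :=
          Finset.sum_le_sum fun x hx => (hν n x ((hmem x).1 hx).1).le
      _ = (ν n : Measure X) (⋃ x ∈ T, Metric.ball x (ε n)) :=
          (measure_biUnion_finset (fun x hx y hy hxy => h2 x hx y hy hxy)
            fun _ _ => Metric.isOpen_ball.measurableSet).symm
      _ ≤ (ν n : Measure X) G := measure_mono (Set.iUnion₂_subset h1)
  have hlim : Tendsto (fun n => ∑ x ∈ T, ((μ : Measure X) {x} - ENNReal.ofReal (ε n))) atTop
      (𝓝 (∑ x ∈ T, (μ : Measure X) {x})) := by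
    refine tendsto_finsetSum _ fun x _ => ?_
    have := ENNReal.Tendsto.sub (tendsto_const_nhds (x := (μ : Measure X) {x}) (f := atTop))
      (ENNReal.tendsto_ofReal hε) (Or.inl (measure_ne_top _ _))
    simpa using this
  calc (μ : Measure X) G ≤ ∑ x ∈ T, (μ : Measure X) {x} := hμG
    _ = liminf (fun n => ∑ x ∈ T, ((μ : Measure X) {x} - ENNReal.ofReal (ε n))) atTop :=
        hlim.liminf_eq.symm
    _ ≤ _ := liminf_le_liminf hle

theorem exists_massNear_subset [BorelSpace X] [HereditarilyLindelofSpace X]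
    (hfin : (msupp μ).Finite) {U : Set (ProbabilityMeasure X)} (hU : U ∈ 𝓝 μ) {r : ℝ}
    (hr : 0 < r) : ∃ ε, 0 < ε ∧ ε < r ∧ massNear μ ε ⊆ U := by
  by_contra! hcon
  have hpos : ∀ n : ℕ, 0 < r / ((n : ℝ) + 2) := fun n => by positivity
  have hlt : ∀ n : ℕ, r / ((n : ℝ) + 2) < r := fun n =>
    div_lt_self hr (by have : (0 : ℝ) ≤ n := n.cast_nonneg; linarith)
  choose ν hν hνU using fun n : ℕ => Set.not_subset.1 (hcon _ (hpos n) (hlt n))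
  have hlim : Tendsto (fun n : ℕ => r / ((n : ℝ) + 2)) atTop (𝓝 0) :=
    tendsto_const_nhds.div_atTop
      (tendsto_atTop_add_const_right _ _ tendsto_natCast_atTop_atTop)
  obtain ⟨n, hn⟩ := ((tendsto_of_mem_massNear hfin hlim hν).eventually_mem hU).exists
  exact hνU n hn

end MassNear

end MeasureTheory.ProbabilityMeasure

theorem exists_continuousMap_bump {X : Type*} [MetricSpace X] {S W : Set X} (hS : S.Finite)
    (hW : IsOpen W) (hSW : S ⊆ W) : ∃ r > 0, ∃ φ : C(X, ℝ≥0), (∀ x, φ x ≤ 1) ∧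
      (∀ x ∉ W, φ x = 0) ∧ ∀ x ∈ S, ∀ y ∈ Metric.closedBall x r, φ y = 1 := by
  obtain ⟨r, hr, hrW⟩ : ∃ r > 0, Metric.cthickening r S ⊆ W :=
    hS.isCompact.exists_cthickening_subset_open hW hSW
  obtain ⟨f, hf0, hf1, hf⟩ := exists_continuous_zero_one_of_isClosed hW.isClosed_compl
    (Metric.isClosed_cthickening (δ := r) (E := S))
    (Set.disjoint_left.2 fun x hx hx' => hx (hrW hx'))
  refine ⟨r, hr, ⟨fun x => (f x).toNNReal, by fun_prop⟩, fun x => ?_, fun x hx => ?_,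
    fun x hx y hy => ?_⟩
  · simpa using (hf x).2
  · simp [hf0 hx]
  · simp [hf1 (Metric.closedBall_subset_cthickening hx r hy)]

theorem stmt_12 {X : Type*} [MetricSpace X] [CompactSpace X] [MeasurableSpace X] [BorelSpace X]
    (𝒲 : Set (Set X)) (hWopen : ∀ W ∈ 𝒲, IsOpen W) (hWcover : ⋃₀ 𝒲 = Set.univ)
    (D : ℝ) (hD : 0 < D) (hWbdd : ∀ W ∈ 𝒲, Metric.diam W < D)
    (μ : VietorisThickening 𝒲) (U : Set (VietorisThickening 𝒲)) (hU : U ∈ nhds μ) :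
    ∃ V : Set (VietorisThickening 𝒲), V ∈ nhds μ ∧ V ⊆ U ∧
      ∃ (hμV : μ ∈ V) (H : unitInterval × V → V),
        Continuous H ∧
        (∀ ν : V, H (0, ν) = ν) ∧
        (∀ ν : V, H (1, ν) = ⟨μ, hμV⟩) ∧
        (∀ t : unitInterval, H (t, ⟨μ, hμV⟩) = ⟨μ, hμV⟩) := by
  obtain ⟨hfin, W, hW, hSW⟩ := μ.2
  obtain ⟨U', hU', hU'U⟩ := mem_nhds_subtype _ _ _ |>.1 hU
  obtain ⟨r, hr, φ, hφ1, hφ0, hφS⟩ := exists_continuousMap_bump hfin (hWopen W hW) hSW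
  obtain ⟨ε, hε, hεr, hεU⟩ := ProbabilityMeasure.exists_massNear_subset hfin hU' hr
  have hφball : ∀ x ∈ msupp μ.1, ∀ y ∈ Metric.ball x ε, φ y = 1 := fun x hx y hy =>
    hφS x hx y (Metric.ball_subset_closedBall (Metric.ball_subset_ball hεr.le hy))
  have hμ : μ.1 ∈ ProbabilityMeasure.massNear μ.1 ε :=
    ProbabilityMeasure.self_mem_massNear hfin hε
  have hpos : ∀ ν ∈ ProbabilityMeasure.massNear μ.1 ε, ∫⁻ x, φ x ∂(ν : Measure X) ≠ 0 := by
    intro ν hν h0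
    obtain ⟨x, hx⟩ := msupp_nonempty μ.1
    rw [lintegral_eq_zero_iff (by fun_prop)] at h0
    refine (hν x hx).not_ge (le_of_eq_of_le (measure_mono_null (fun y hy => ?_) h0) zero_le)
    simp [hφball x hx y hy]
  have hreweight : ∀ ν (hν : ν ∈ ProbabilityMeasure.massNear μ.1 ε),
      ν.reweight φ (hpos ν hν) ∈ ProbabilityMeasure.massNear μ.1 ε := fun ν hν x hx =>
    (hν x hx).trans_le (ProbabilityMeasure.le_reweight_apply _ hφ1
      Metric.isOpen_ball.measurableSet (hφball x hx))
  have hself : μ.1.reweight φ (hpos _ hμ) = μ.1 := by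
    refine ProbabilityMeasure.reweight_eq_self _ ?_
    filter_upwards [mem_ae_iff.2 (measure_compl_msupp μ.1)] with x hxS
    exact hφS x hxS x (Metric.mem_closedBall_self hr.le)
  have hthick : ∀ (κ : ProbabilityMeasure X) (T W' : Set X), T.Finite → W' ∈ 𝒲 → T ⊆ W' →
      (κ : Measure X) Tᶜ = 0 → κ ∈ VietorisThickening 𝒲 := fun κ T W' hT hW' hTW h0 =>
    have hsub := msupp_subset_of_isClosed hT.isClosed h0
    ⟨hT.subset hsub, W', hW', hsub.trans hTW⟩
  let α : unitInterval → unitInterval := fun t => Set.projIcc 0 1 zero_le_one (2 * (t : ℝ))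
  let β : unitInterval → unitInterval := fun t => Set.projIcc 0 1 zero_le_one (2 * (t : ℝ) - 1)
  have hα : Continuous α := continuous_projIcc.comp (by fun_prop)
  have hβ : Continuous β := continuous_projIcc.comp (by fun_prop)
  have hα0 : α 0 = 0 := Set.projIcc_of_le_left _ (by simp)
  have hβ0 : β 0 = 0 := Set.projIcc_of_le_left _ (by simp)
  have hβ1 : β 1 = 1 := Set.projIcc_of_right_le _ (by norm_num)
  have hαβ : ∀ t, β t = 0 ∨ α t = 1 := fun t => by
    rcases le_total (2 * (t : ℝ)) 1 with h | h
    · exact Or.inl (Set.projIcc_of_le_left _ (by linarith))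
    · exact Or.inr (Set.projIcc_of_right_le _ h)
  let V : Set (VietorisThickening 𝒲) := Subtype.val ⁻¹' ProbabilityMeasure.massNear μ.1 ε
  let K : unitInterval × V → ProbabilityMeasure X := fun p =>
    .mix (β p.1) (.mix (α p.1) p.2.1.1 (p.2.1.1.reweight φ (hpos _ p.2.2))) μ.1
  have hKcont : Continuous K := by
    have hval : Continuous fun p : unitInterval × V => p.2.1.1 := by fun_prop
    exact ProbabilityMeasure.continuous_mix (hβ.comp continuous_fst)
      (ProbabilityMeasure.continuous_mix (hα.comp continuous_fst) hval
        (ProbabilityMeasure.continuous_reweight hval fun p => hpos _ p.2.2)) continuous_const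
  have hKnear : ∀ p, K p ∈ ProbabilityMeasure.massNear μ.1 ε := fun p =>
    ProbabilityMeasure.mix_mem_massNear
      (ProbabilityMeasure.mix_mem_massNear p.2.2 (hreweight _ p.2.2) _) hμ _
  have hKthick : ∀ p, K p ∈ VietorisThickening 𝒲 := by
    rintro ⟨t, ν, hν⟩
    obtain ⟨hνfin, W', hW', hνW'⟩ := ν.2
    have hνsupp := measure_compl_msupp ν.1
    rcases hαβ t with h | h
    · refine hthick _ (msupp ν.1) W' hνfin hW' hνW' ?_
      simp only [K, h, ProbabilityMeasure.mix_zero]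
      exact ProbabilityMeasure.mix_apply_eq_zero hνsupp
        (ProbabilityMeasure.reweight_apply_eq_zero _ hνsupp)
    · refine hthick _ (msupp ν.1 ∩ W ∪ msupp μ.1) W ((hνfin.inter_of_left W).union hfin) hW
        (Set.union_subset Set.inter_subset_right hSW) ?_
      simp only [K, h, ProbabilityMeasure.mix_one]
      refine ProbabilityMeasure.mix_apply_eq_zero (measure_mono_null ?_ (measure_union_null
        (ProbabilityMeasure.reweight_apply_eq_zero (hpos _ hν) hνsupp)
        (ProbabilityMeasure.reweight_apply_setOf_eq_zero (hpos _ hν))))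
        (measure_mono_null (Set.compl_subset_compl.2 Set.subset_union_right)
          (measure_compl_msupp μ.1))
      intro x hx
      by_cases hxν : x ∈ msupp ν.1
      · exact Or.inr (hφ0 x fun hxW => hx (Or.inl ⟨hxν, hxW⟩))
      · exact Or.inl hxν
  refine ⟨V, ?_, fun ν hν => hU'U (hεU hν), hμ, fun p => ⟨⟨K p, hKthick p⟩, hKnear p⟩,
    (hKcont.subtype_mk _).subtype_mk _, fun ν => ?_, fun ν => ?_, fun t => ?_⟩
  · exact ((ProbabilityMeasure.isOpen_massNear hfin).preimage continuous_subtype_val).mem_nhds hμ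
  · exact Subtype.ext (Subtype.ext (by simp [K, hα0, hβ0]))
  · exact Subtype.ext (Subtype.ext (by simp [K, hβ1]))
  · exact Subtype.ext (Subtype.ext (by simp [K, hself]))
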